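/- Let {X_1, …, X_K} be a minimal subspace segmentation of X with no pure segment, and let J = {J_1, …, J_K} ∈ J(K, d, d_min). If no sample x_j lies in S_k ∩ S_ℓ for any k ≠ ℓ, then for every piece J_i and every pair of distinct indices s ≠ t: r(X_{J_i}) ≥ min(|J_{is}|, d_s) + (min(|J_{it}|, d_t) − d_int)_+ + Σ_{k≠s,t} (min(|J_{ik}|, d_k) − d_0)_+. Furthermore, if {X_1, …, X_K} is intersected nondegenerately, then: (a) r(X_{J_i}) ≥ d_min for every J_i having exactly one nonempty piece J_{is}; and (b) r(X_{J_i}) > d_min for every J_i having at least two nonempty pieces J_{is} and J_{it}. -/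

import Mathlib

open Submodule Module Finset

noncomputable section

variable {m : ℕ} {ι : Type*}

/-- The subspace spanned by the subfamily of `x` indexed by `S`. -/
def spanOf (x : ι → EuclideanSpace ℝ (Fin m)) (S : Finset ι) :
    Submodule ℝ (EuclideanSpace ℝ (Fin m)) :=
  Submodule.span ℝ (x '' (S : Set ι))

/-- The rank `r(X_S)` of the subfamily of `x` indexed by `S`. -/
def rOf (x : ι → EuclideanSpace ℝ (Fin m)) (S : Finset ι) : ℕ :=
  Module.finrank ℝ (spanOf x S)

/-- `X_S` is nondegenerate: every subfamily `X_T`, `T ⊆ S`, has rank `min |T| r(X_S)`. -/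
def Nondeg (x : ι → EuclideanSpace ℝ (Fin m)) (S : Finset ι) : Prop :=
  ∀ T ⊆ S, rOf x T = min T.card (rOf x S)

/-- `span(X_S)` is a minimal sample subspace: `n(X_S) > r(X_S)` and `X_S` is nondegenerate. -/
def IsMinimalSeg (x : ι → EuclideanSpace ℝ (Fin m)) (S : Finset ι) : Prop :=
  rOf x S < S.card ∧ Nondeg x S

/-- The component of `x i` in the orthogonal complement of `W ⊓ S'` within `W`. -/
def zComp (x : ι → EuclideanSpace ℝ (Fin m))
    (W S' : Submodule ℝ (EuclideanSpace ℝ (Fin m))) (i : ι) :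
    EuclideanSpace ℝ (Fin m) :=
  (orthogonalProjection (W ⊓ (W ⊓ S')ᗮ) (x i) : EuclideanSpace ℝ (Fin m))

/-- The segmentation `{X_1, …, X_K}` is intersected nondegenerately: for every `k` and every
subfamily indexed by `S` disjoint from `P k`, the family of components of the vectors of `X_k`
in the orthogonal complement (within `span(X_k)`) of `span(X_k) ⊓ span(X_S)` is zero or
nondegenerate. -/
def IntNondeg (x : ι → EuclideanSpace ℝ (Fin m)) {K : ℕ}
    (P : Fin K → Finset ι) : Prop :=
  ∀ (k : Fin K) (S : Finset ι), Disjoint S (P k) →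
    (∀ i ∈ P k, zComp x (spanOf x (P k)) (spanOf x S) i = 0) ∨
      Nondeg (zComp x (spanOf x (P k)) (spanOf x S)) (P k)

/-- A minimal subspace segmentation of `X` with no pure segment, with index pieces
`P 1, …, P K`. -/
structure IsMSSnp (x : ι → EuclideanSpace ℝ (Fin m)) {K : ℕ}
    (P : Fin K → Finset ι) : Prop where
  cover : ∀ i : ι, ∃ k, i ∈ P k
  disj : ∀ k ℓ, k ≠ ℓ → Disjoint (P k) (P ℓ)
  minimal : ∀ k, IsMinimalSeg x (P k)
  distinct : ∀ k ℓ, k ≠ ℓ → spanOf x (P k) ≠ spanOf x (P ℓ)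

/-- The non-intersection condition for the minimal segments. -/
def NonIntersect (x : ι → EuclideanSpace ℝ (Fin m)) {K : ℕ}
    (P : Fin K → Finset ι) : Prop :=
  ∀ (j : ι) (k ℓ : Fin K), k ≠ ℓ → x j ∉ spanOf x (P k) ⊓ spanOf x (P ℓ)

/-- The set `𝒥(K, d, dmin)`: partitions of the index set into `K` pieces, each of size
greater than `dmin`, whose segment ranks sum to at most `d`. -/
def InJSet (x : ι → EuclideanSpace ℝ (Fin m)) (K d dmin : ℕ)
    (Q : Fin K → Finset ι) : Prop :=
  (∀ i : ι, ∃ k, i ∈ Q k) ∧ (∀ k ℓ, k ≠ ℓ → Disjoint (Q k) (Q ℓ)) ∧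
    (∀ k, dmin < (Q k).card) ∧ (∑ k, rOf x (Q k)) ≤ d

theorem spanOf_mono (x : ι → EuclideanSpace ℝ (Fin m)) {S T : Finset ι} (h : S ⊆ T) :
    spanOf x S ≤ spanOf x T :=
  Submodule.span_mono (Set.image_mono (by exact_mod_cast h))

theorem mem_spanOf (x : ι → EuclideanSpace ℝ (Fin m)) {S : Finset ι} {i : ι} (h : i ∈ S) :
    x i ∈ spanOf x S :=
  Submodule.subset_span ⟨i, by exact_mod_cast h, rfl⟩

theorem linearIndepOn_iff_rOf_eq_card (x : ι → EuclideanSpace ℝ (Fin m)) (S : Finset ι) :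
    LinearIndepOn ℝ x (S : Set ι) ↔ rOf x S = S.card := by
  have h := linearIndependent_iff_card_eq_finrank_span (R := ℝ)
    (b := fun i : (S : Set ι) => x i)
  rw [LinearIndepOn, h, Set.finrank, rOf, spanOf, Set.image_eq_range]
  simp [eq_comm]

/-- Adding a subspace `V` to `U` raises the dimension by at least `dim V - dim (U ⊓ V)`. -/
theorem finrank_add_tsub_le_finrank_sup {V : Type*} [AddCommGroup V] [Module ℝ V]
    [FiniteDimensional ℝ V] (U W : Submodule ℝ V) {c : ℕ}
    (h : Module.finrank ℝ ↥(U ⊓ W) ≤ c) :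
    Module.finrank ℝ U + (Module.finrank ℝ W - c) ≤ Module.finrank ℝ ↥(U ⊔ W) := by
  have h₁ := Submodule.finrank_sup_add_finrank_inf_eq U W
  have h₂ : Module.finrank ℝ U ≤ Module.finrank ℝ ↥(U ⊔ W) :=
    Submodule.finrank_mono le_sup_left
  omega

theorem rank_lower_bound_of_subspaces {V κ : Type*} [AddCommGroup V] [Module ℝ V]
    [FiniteDimensional ℝ V] [DecidableEq κ] (A S : κ → Submodule ℝ V) (hA : ∀ k, A k ≤ S k)
    {c₀ c : ℕ} (hc₀ : ∀ k, Module.finrank ℝ ↥(S k ⊓ ⨆ (j) (_ : j ≠ k), S j) ≤ c₀)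
    (hc : ∀ k l, k ≠ l → Module.finrank ℝ ↥(S k ⊓ S l) ≤ c)
    {s t : κ} (hst : s ≠ t) (T : Finset κ) (hs : s ∉ T) (ht : t ∉ T) :
    Module.finrank ℝ (A s) + (Module.finrank ℝ (A t) - c) +
        ∑ k ∈ T, (Module.finrank ℝ (A k) - c₀) ≤
      Module.finrank ℝ ↥(A s ⊔ A t ⊔ T.sup A) := by
  induction T using Finset.induction_on with
  | empty =>
    rw [Finset.sum_empty, add_zero, Finset.sup_empty, sup_bot_eq]
    exact finrank_add_tsub_le_finrank_sup (A s) (A t)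
      ((Submodule.finrank_mono (inf_le_inf (hA s) (hA t))).trans (hc s t hst))
  | insert k T hk ih =>
    rw [Finset.mem_insert, not_or] at hs ht
    have hle : A s ⊔ A t ⊔ T.sup A ≤ ⨆ (j) (_ : j ≠ k), S j := by
      have hj : ∀ j, j ≠ k → A j ≤ ⨆ (j) (_ : j ≠ k), S j := fun j hj =>
        (hA j).trans (le_iSup₂_of_le j hj le_rfl)
      refine sup_le (sup_le (hj s hs.1) (hj t ht.1)) (Finset.sup_le fun j hjT => hj j ?_)
      rintro rfl
      exact hk hjT
    have hstep := finrank_add_tsub_le_finrank_sup (A s ⊔ A t ⊔ T.sup A) (A k) (c := c₀)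
      ((Submodule.finrank_mono ((inf_le_inf hle (hA k)).trans_eq (inf_comm _ _))).trans (hc₀ k))
    have heq : A s ⊔ A t ⊔ (insert k T).sup A = A s ⊔ A t ⊔ T.sup A ⊔ A k := by
      rw [Finset.sup_insert, sup_comm (A k), ← sup_assoc]
    rw [heq, Finset.sum_insert hk]
    have := ih hs.2 ht.2
    omega

theorem sub_zComp_mem (x : ι → EuclideanSpace ℝ (Fin m))
    (W S : Submodule ℝ (EuclideanSpace ℝ (Fin m))) {i : ι} (hi : x i ∈ W) :
    x i - zComp x W S i ∈ S := by
  set U := W ⊓ S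
  have hsplit : W ≤ U ⊔ W ⊓ Uᗮ := by
    rw [inf_comm, Submodule.sup_orthogonal_inf_of_hasOrthogonalProjection inf_le_left]
  obtain ⟨u, hu, v, hv, huv⟩ := Submodule.mem_sup.1 (hsplit hi)
  have hproj : zComp x W S i = v := by
    refine Submodule.eq_starProjection_of_mem_of_inner_eq_zero hv fun w hw => ?_
    rw [← huv, add_sub_cancel_right]
    exact (Submodule.mem_inf.1 hw).2 u hu
  rw [hproj, ← huv, add_sub_cancel_right]
  exact hu.2

/-- If `X_Q` does not span the segment `X_P`, the components of its members from that segment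
are linearly independent. -/
theorem linearIndepOn_zComp [DecidableEq ι] (x : ι → EuclideanSpace ℝ (Fin m)) (P Q : Finset ι)
    (hz : (∀ i ∈ P, zComp x (spanOf x P) (spanOf x (Q \ P)) i = 0) ∨
      Nondeg (zComp x (spanOf x P) (spanOf x (Q \ P))) P)
    (hPQ : ¬ spanOf x P ≤ spanOf x Q) :
    LinearIndepOn ℝ (zComp x (spanOf x P) (spanOf x (Q \ P))) (Q ∩ P : Finset ι) := by
  set z := zComp x (spanOf x P) (spanOf x (Q \ P))
  have hsub : ∀ i ∈ P, x i - z i ∈ spanOf x Q := fun i hi =>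
    spanOf_mono x Finset.sdiff_subset (sub_zComp_mem x _ _ (mem_spanOf x hi))
  by_contra hdep
  refine hPQ (Submodule.span_le.2 ?_)
  rintro _ ⟨i, hi, rfl⟩
  suffices z i ∈ spanOf x Q by simpa using add_mem (hsub i hi) this
  rcases hz with hz | hz
  · rw [hz i hi]
    exact zero_mem _
  · have hcard := hz _ (Finset.inter_subset_right (s₁ := Q))
    rw [linearIndepOn_iff_rOf_eq_card] at hdep
    have hr : rOf z (Q ∩ P) = rOf z P := by omega
    have hspan : spanOf z (Q ∩ P) = spanOf z P :=
      Submodule.eq_of_le_of_finrank_eq (spanOf_mono z Finset.inter_subset_right) hr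
    have hzQ : spanOf z (Q ∩ P) ≤ spanOf x Q := by
      refine Submodule.span_le.2 ?_
      rintro _ ⟨j, hj, rfl⟩
      obtain ⟨hjQ, hjP⟩ := Finset.mem_inter.1 (Finset.mem_coe.1 hj)
      simpa using sub_mem (mem_spanOf x hjQ) (hsub j hjP)
    exact hzQ (hspan ▸ mem_spanOf z hi)

/-- A linear relation on `X_Q` projects to a linear relation on the components of its members
from the segment `X_P`. -/
theorem sum_smul_zComp_eq_zero [DecidableEq ι] (x : ι → EuclideanSpace ℝ (Fin m)) (P Q : Finset ι)
    (c : ι → ℝ) (hc : ∑ i ∈ Q, c i • x i = 0) :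
    ∑ i ∈ Q ∩ P, c i • zComp x (spanOf x P) (spanOf x (Q \ P)) i = 0 := by
  set U := spanOf x P ⊓ spanOf x (Q \ P)
  have hmem : ∀ T : Finset ι, ∑ i ∈ T, c i • x i ∈ spanOf x T := fun T =>
    sum_mem fun i hi => smul_mem _ _ (mem_spanOf x hi)
  have hU : ∑ i ∈ Q ∩ P, c i • x i ∈ U := by
    refine ⟨spanOf_mono x Finset.inter_subset_right (hmem _), ?_⟩
    have hsum := Finset.sum_inter_add_sum_sdiff Q P fun i => c i • x i
    rw [hc] at hsum
    rw [eq_neg_of_add_eq_zero_left hsum]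
    exact neg_mem (hmem _)
  have hproj : (spanOf x P ⊓ Uᗮ).starProjection (∑ i ∈ Q ∩ P, c i • x i) = 0 := by
    rw [Submodule.starProjection_apply_eq_zero_iff]
    exact Submodule.orthogonal_le inf_le_right (Submodule.le_orthogonal_orthogonal U hU)
  rw [map_sum] at hproj
  simp only [map_smul] at hproj
  exact hproj

/-- If `X_Q` spans none of the segments, it is linearly independent. -/
theorem linearIndepOn_of_not_spanOf_le [DecidableEq ι] (x : ι → EuclideanSpace ℝ (Fin m)) {K : ℕ}
    (P : Fin K → Finset ι) (hcover : ∀ i, ∃ k, i ∈ P k) (hnd : IntNondeg x P) (Q : Finset ι)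
    (hPQ : ∀ k, ¬ spanOf x (P k) ≤ spanOf x Q) :
    LinearIndepOn ℝ x (Q : Set ι) := by
  rw [linearIndepOn_finset_iff]
  intro c hc i hi
  obtain ⟨k, hk⟩ := hcover i
  have hind := linearIndepOn_zComp x (P k) Q (hnd k _ Finset.sdiff_disjoint) (hPQ k)
  rw [linearIndepOn_finset_iff] at hind
  exact hind c (sum_smul_zComp_eq_zero x (P k) Q c hc) i (Finset.mem_inter.2 ⟨hi, hk⟩)

/-- rank estimates for the pieces of a partition in `𝒥(K, d, dmin)`. -/
theorem rank_estimate [Fintype ι] [DecidableEq ι]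
    (x : ι → EuclideanSpace ℝ (Fin m)) {K : ℕ} (P : Fin K → Finset ι)
    (hmss : IsMSSnp x P)
    (d dmin d0 dint : ℕ)
    (hd : d = ∑ k, rOf x (P k))
    (hdmin : IsLeast (Set.range fun k => rOf x (P k)) dmin)
    (hd0 : IsGreatest (Set.range fun k =>
      Module.finrank ℝ ↥(spanOf x (P k) ⊓ ⨆ (j) (_ : j ≠ k), spanOf x (P j))) d0)
    (hdint : IsGreatest {r | ∃ k ℓ : Fin K, k ≠ ℓ ∧
      r = Module.finrank ℝ ↥(spanOf x (P k) ⊓ spanOf x (P ℓ))} dint)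
    (Q : Fin K → Finset ι) (hQ : InJSet x K d dmin Q)
    (hni : ∀ (j : ι) (k ℓ : Fin K), k ≠ ℓ → x j ∉ spanOf x (P k) ⊓ spanOf x (P ℓ)) :
    (∀ i s t : Fin K, s ≠ t →
      min (Q i ∩ P s).card (rOf x (P s)) +
          (min (Q i ∩ P t).card (rOf x (P t)) - dint) +
          ∑ k ∈ Finset.univ \ {s, t}, (min (Q i ∩ P k).card (rOf x (P k)) - d0) ≤
        rOf x (Q i)) ∧
    (IntNondeg x P →
      (∀ i s : Fin K, (Q i ∩ P s).Nonempty → (∀ k, k ≠ s → Q i ∩ P k = ∅) →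
        dmin ≤ rOf x (Q i)) ∧
      (∀ i s t : Fin K, s ≠ t → (Q i ∩ P s).Nonempty → (Q i ∩ P t).Nonempty →
        dmin < rOf x (Q i))) := by
  have hrank : ∀ i k, rOf x (Q i ∩ P k) = min (Q i ∩ P k).card (rOf x (P k)) := fun i k =>
    (hmss.minimal k).2 _ Finset.inter_subset_right
  have hmin : ∀ k, dmin ≤ rOf x (P k) := fun k => hdmin.2 ⟨k, rfl⟩
  refine ⟨fun i s t hst => ?_, fun hnd => ⟨fun i s _ hs => ?_, fun i s t hst hs ht => ?_⟩⟩
  · simp only [← hrank]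
    have hbound := rank_lower_bound_of_subspaces (fun k => spanOf x (Q i ∩ P k))
      (fun k => spanOf x (P k)) (fun k => spanOf_mono x Finset.inter_subset_right)
      (fun k => hd0.2 ⟨k, rfl⟩) (fun k l hkl => hdint.2 ⟨k, l, hkl, rfl⟩) hst
      (Finset.univ \ {s, t}) (by simp) (by simp)
    have hle : ∀ k, spanOf x (Q i ∩ P k) ≤ spanOf x (Q i) := fun k =>
      spanOf_mono x Finset.inter_subset_left
    exact hbound.trans (Submodule.finrank_mono
      (sup_le (sup_le (hle s) (hle t)) (Finset.sup_le fun k _ => hle k)))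
  · have hsub : Q i ⊆ P s := by
      intro j hj
      obtain ⟨k, hk⟩ := hmss.cover j
      by_cases hks : k = s
      · exact hks ▸ hk
      · simpa [hs k hks] using Finset.mem_inter.2 ⟨hj, hk⟩
    rw [(hmss.minimal s).2 _ hsub]
    exact le_min (hQ.2.2.1 i).le (hmin s)
  · by_contra! hle
    have hnot : ∀ k, ¬ spanOf x (P k) ≤ spanOf x (Q i) := by
      intro k hk
      have heq : spanOf x (P k) = spanOf x (Q i) :=
        Submodule.eq_of_le_of_finrank_le hk (hle.trans (hmin k))
      obtain ⟨l, hl, hne⟩ : ∃ l, l ≠ k ∧ (Q i ∩ P l).Nonempty := by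
        by_cases hks : s = k
        · exact ⟨t, fun h => hst (hks.trans h.symm), ht⟩
        · exact ⟨s, hks, hs⟩
      obtain ⟨j, hj⟩ := hne
      obtain ⟨hjQ, hjP⟩ := Finset.mem_inter.1 hj
      exact hni j l k hl ⟨mem_spanOf x hjP, heq ▸ mem_spanOf x hjQ⟩
    have hcard := (linearIndepOn_iff_rOf_eq_card x (Q i)).1
      (linearIndepOn_of_not_spanOf_le x P hmss.cover hnd (Q i) hnot)
    have := hQ.2.2.1 i
    omega
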